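/- Let X₁ be a J × N real matrix, Y a J × M real matrix, B an N × R real matrix and C an M × R real matrix, and define f(U) = ‖X₁ − U Bᵀ‖² + ‖Y − U Cᵀ‖² (squared Frobenius norms). Assume (BᵀB)_{r r} + (CᵀC)_{r r} > 0 for every r ∈ Fin R. Let (j_i, r_i)_{i ∈ ℕ} be an arbitrary sequence of coordinate choices, let U⁰ be any J × R matrix with nonnegative entries, and define U^{i+1} from U^i by replacing the (j_i, r_i) entry with max(0, U^i_{j_i r_i} − g_i/h_i), where g_i = (U^i BᵀB − X₁ B + U^i CᵀC − Y C)_{j_i r_i} and h_i = (BᵀB)_{r_i r_i} + (CᵀC)_{r_i r_i}. Then the sequence (f(U^i))_{i ∈ ℕ} is nonincreasing, bounded below by 0, and converges to a limit. -/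

import Mathlib

open scoped BigOperators
open Matrix

/-- Squared Frobenius norm: sum of squares of the entries. -/
def frobSq {m n : Type*} [Fintype m] [Fintype n] (A : Matrix m n ℝ) : ℝ :=
  ∑ i, ∑ j, A i j ^ 2

/-- Replace the (j,r) entry of U by v. -/
def updEntry {J R : ℕ} (U : Matrix (Fin J) (Fin R) ℝ) (j : Fin J) (r : Fin R) (v : ℝ) :
    Matrix (Fin J) (Fin R) ℝ :=
  Matrix.of fun a b => if a = j ∧ b = r then v else U a b

theorem frobSq_nonneg {m n : Type*} [Fintype m] [Fintype n] (A : Matrix m n ℝ) :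
    0 ≤ frobSq A :=
  Finset.sum_nonneg fun _ _ => Finset.sum_nonneg fun _ _ => sq_nonneg _

/-- The squared Frobenius norm after a rank-one perturbation of a single row. -/
theorem frobSq_sub_ite_row {m n : Type*} [Fintype m] [Fintype n] [DecidableEq m]
    (E : Matrix m n ℝ) (j : m) (w : n → ℝ) :
    frobSq (E - Matrix.of fun a k => if a = j then w k else 0) =
      frobSq E - 2 * ∑ k, E j k * w k + ∑ k, w k ^ 2 := by
  have h : ∀ a, ∑ k, (E a k - if a = j then w k else 0) ^ 2 =
      ∑ k, E a k ^ 2 + if a = j then -2 * ∑ k, E j k * w k + ∑ k, w k ^ 2 else 0 := by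
    intro a
    split_ifs with ha
    · subst ha
      rw [Finset.mul_sum, ← Finset.sum_add_distrib, ← Finset.sum_add_distrib]
      exact Finset.sum_congr rfl fun k _ => by ring
    · simp
  simp only [frobSq, Matrix.sub_apply, Matrix.of_apply, h, Finset.sum_add_distrib,
    Finset.sum_ite_eq', Finset.mem_univ, if_true]
  ring

theorem updEntry_mul_transpose {J R N : ℕ} (U : Matrix (Fin J) (Fin R) ℝ)
    (B : Matrix (Fin N) (Fin R) ℝ) (j : Fin J) (r : Fin R) (v : ℝ) :
    updEntry U j r v * Bᵀ =
      U * Bᵀ + Matrix.of fun a k => if a = j then (v - U j r) * B k r else 0 := by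
  ext a k
  have h : ∀ b, updEntry U j r v a b * B k b =
      U a b * B k b + if b = r then (if a = j then (v - U j r) * B k r else 0) else 0 := by
    intro b
    by_cases ha : a = j <;> by_cases hb : b = r <;> simp [updEntry, ha, hb]
    ring
  simp [Matrix.mul_apply, h, Finset.sum_add_distrib]

/-- The least-squares objective is quadratic in each entry of the factor. -/
theorem frobSq_sub_updEntry_mul_transpose {J R N : ℕ} (X : Matrix (Fin J) (Fin N) ℝ)
    (U : Matrix (Fin J) (Fin R) ℝ) (B : Matrix (Fin N) (Fin R) ℝ)
    (j : Fin J) (r : Fin R) (v : ℝ) :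
    frobSq (X - updEntry U j r v * Bᵀ) =
      frobSq (X - U * Bᵀ) + 2 * (v - U j r) * (U * Bᵀ * B - X * B) j r +
        (v - U j r) ^ 2 * (Bᵀ * B) r r := by
  have hg : ∑ k, (X - U * Bᵀ) j k * ((v - U j r) * B k r) =
      -((v - U j r) * (U * Bᵀ * B - X * B) j r) := by
    rw [← Matrix.sub_mul, Matrix.mul_apply, Finset.mul_sum, ← Finset.sum_neg_distrib]
    refine Finset.sum_congr rfl fun k _ => ?_
    simp only [Matrix.sub_apply]
    ring
  have hq : ∑ k, ((v - U j r) * B k r) ^ 2 = (v - U j r) ^ 2 * (Bᵀ * B) r r := by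
    rw [Matrix.mul_apply, Finset.mul_sum]
    refine Finset.sum_congr rfl fun k _ => ?_
    simp only [Matrix.transpose_apply]
    ring
  rw [updEntry_mul_transpose, ← sub_sub, frobSq_sub_ite_row, hg, hq]
  ring

/-- A projected Newton step from `a ≥ 0` does not increase a convex quadratic. -/
theorem quadratic_projected_step_nonpos {a g h : ℝ} (ha : 0 ≤ a) (hh : 0 < h) :
    2 * (max 0 (a - g / h) - a) * g + (max 0 (a - g / h) - a) ^ 2 * h ≤ 0 := by
  obtain ⟨t, rfl⟩ : ∃ t, g = t * h := ⟨g / h, by field_simp⟩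
  rw [mul_div_cancel_right₀ _ hh.ne']
  have key : (max 0 (a - t) - a) * (2 * t + (max 0 (a - t) - a)) ≤ 0 := by
    rcases max_cases 0 (a - t) with ⟨e, _⟩ | ⟨e, _⟩ <;> rw [e] <;> nlinarith [sq_nonneg t]
  nlinarith [mul_nonneg (neg_nonneg.2 key) hh.le]

/-- Convergence of the Cut-CD coordinate-descent update sequence (Theorem 5.1): for any
sequence of coordinate choices, the N-CMTF objective values are nonincreasing, bounded below
by 0, and converge. -/
theorem cutcd_objective_converges {J N M R : ℕ}
    (X₁ : Matrix (Fin J) (Fin N) ℝ) (Y : Matrix (Fin J) (Fin M) ℝ)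
    (B : Matrix (Fin N) (Fin R) ℝ) (C : Matrix (Fin M) (Fin R) ℝ)
    (hh : ∀ r : Fin R, 0 < (Bᵀ * B) r r + (Cᵀ * C) r r)
    (js : ℕ → Fin J) (rs : ℕ → Fin R)
    (Useq : ℕ → Matrix (Fin J) (Fin R) ℝ)
    (h0 : ∀ a b, 0 ≤ Useq 0 a b)
    (hstep : ∀ i : ℕ,
      Useq (i + 1) =
        updEntry (Useq i) (js i) (rs i)
          (max 0 (Useq i (js i) (rs i) -
            (Useq i * Bᵀ * B - X₁ * B + Useq i * Cᵀ * C - Y * C) (js i) (rs i) /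
              ((Bᵀ * B) (rs i) (rs i) + (Cᵀ * C) (rs i) (rs i))))) :
    let f : Matrix (Fin J) (Fin R) ℝ → ℝ :=
      fun A => frobSq (X₁ - A * Bᵀ) + frobSq (Y - A * Cᵀ)
    (∀ i : ℕ, f (Useq (i + 1)) ≤ f (Useq i)) ∧
    (∀ i : ℕ, 0 ≤ f (Useq i)) ∧
    ∃ c : ℝ, Filter.Tendsto (fun i => f (Useq i)) Filter.atTop (nhds c) := by
  intro f
  have hU : ∀ i a b, 0 ≤ Useq i a b := by
    intro i
    induction i with
    | zero => exact h0
    | succ i ih =>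
      intro a b
      rw [hstep, updEntry, Matrix.of_apply]
      split_ifs
      · exact le_max_left _ _
      · exact ih a b
  have hf : ∀ i, 0 ≤ f (Useq i) := fun i => add_nonneg (frobSq_nonneg _) (frobSq_nonneg _)
  have hdec : ∀ i, f (Useq (i + 1)) ≤ f (Useq i) := by
    intro i
    have hquad := quadratic_projected_step_nonpos
      (g := (Useq i * Bᵀ * B - X₁ * B + Useq i * Cᵀ * C - Y * C) (js i) (rs i))
      (hU i (js i) (rs i)) (hh (rs i))
    simp only [f]
    rw [hstep i, frobSq_sub_updEntry_mul_transpose, frobSq_sub_updEntry_mul_transpose]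
    generalize max 0 _ = v at hquad ⊢
    simp only [Matrix.sub_apply, Matrix.add_apply] at hquad ⊢
    linarith
  exact ⟨hdec, hf, _, tendsto_atTop_ciInf (antitone_nat_of_succ_le hdec)
    ⟨0, Set.forall_mem_range.2 hf⟩⟩
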